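/- arXiv:2005.03847 — 2 statements merged into one kernel-verified Lean document; each statement's English description precedes it below -/
import Mathlib

section
/- Let (X,d) be a δ-hyperbolic metric space for some δ ≥ 0, and let w, x, y, z ∈ X satisfy (y,z)_w ≥ (x,y)_w and (y,z)_w ≥ (x,z)_w (so that w is sorted into the zone of x). Then |(y,z)_w + (x,z)_y − d(w,y)| ≤ δ and |(y,z)_w + (x,y)_z − d(w,z)| ≤ δ; that is, placing w at distance (y,z)_w from the Steiner node r of the universal tree on x, y, z, on the side of x, introduces an additive distortion of at most δ between w and each of y and z. -/
/-- The Gromov product `(x,y)_w = (d(w,x) + d(w,y) - d(x,y))/2`. -/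
noncomputable def gromov {X : Type*} [MetricSpace X] (x y w : X) : ℝ :=
  (dist w x + dist w y - dist x y) / 2

/-- In a δ-hyperbolic metric space, if `(y,z)_w` is the largest of the three Gromov
products at base `w` (so `w` is sorted into the zone of `x`), then placing `w` at
distance `(y,z)_w` from the Steiner node of the universal tree on `x, y, z`, on the side
of `x`, distorts the distances from `w` to `y` and to `z` by at most `δ`. -/
theorem treerep_additive_distortion {X : Type*} [MetricSpace X]
    (δ : ℝ) (hδ : 0 ≤ δ)
    (hhyp : ∀ w x y z : X, gromov x y w ≥ min (gromov x z w) (gromov y z w) - δ)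
    (w x y z : X)
    (h1 : gromov y z w ≥ gromov x y w) (h2 : gromov y z w ≥ gromov x z w) :
    |gromov y z w + gromov x z y - dist w y| ≤ δ ∧
    |gromov y z w + gromov x y z - dist w z| ≤ δ := by
  have hxy := hhyp w x y z
  have hxz := hhyp w x z y
  have hsymm : gromov z y w = gromov y z w := by
    unfold gromov
    rw [dist_comm z y]
    ring
  rw [min_eq_left h2] at hxy
  rw [hsymm, min_eq_left h1] at hxz
  have hy : gromov y z w + gromov x z y - dist w y = gromov x z w - gromov x y w := by
    unfold gromov
    rw [dist_comm y x]
    ring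
  have hz : gromov y z w + gromov x y z - dist w z = gromov x y w - gromov x z w := by
    unfold gromov
    rw [dist_comm z x, dist_comm z y]
    ring
  rw [hy, hz, abs_le, abs_le]
  exact ⟨⟨by linarith, by linarith⟩, by linarith, by linarith⟩
end

section
/- Let (X,d) be a 0-hyperbolic metric space, let x, y, z ∈ X, and let w, ŵ ∈ X satisfy: (x,y)_w = (x,z)_w = d(w,x) (i.e., w lies in Zone_1(x) of the universal tree on x,y,z), and (x,y)_ŵ = (x,z)_ŵ < d(ŵ,x) (i.e., ŵ lies in Zone_2(x)). Then x lies metrically between w and ŵ: d(w,ŵ) = d(w,x) + d(x,ŵ). -/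
/-- In a 0-hyperbolic metric space, if `w ∈ Zone_1(x)` and `ŵ ∈ Zone_2(x)` relative to
the universal tree on `x, y, z`, then `x` lies metrically between `w` and `ŵ`. -/
theorem zone1_zone2_through_x {X : Type*} [MetricSpace X]
    (hhyp : ∀ w x y z : X, gromov x y w ≥ min (gromov x z w) (gromov y z w))
    (x y z w w' : X)
    (hw1 : gromov x y w = dist w x) (hw2 : gromov x z w = dist w x)
    (hw'1 : gromov x y w' = gromov x z w') (hw'2 : gromov x y w' < dist w' x) :
    dist w w' = dist w x + dist x w' := by
  have h := hhyp x w y w'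
  have htri := dist_triangle w x w'
  simp only [gromov] at *
  rw [dist_comm x w, dist_comm y w', dist_comm x w'] at *
  rcases min_le_iff.mp h with h | h <;> linarith
end
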